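/- Derivative of the KL divergence under a perturbative transport map (Liu–Wang identity, Eq. (2.3) of the paper): let d be a positive integer, let π : ℝ^d → ℝ and q : ℝ^d → ℝ be strictly positive continuously differentiable probability densities with respect to Lebesgue measure such that the Kullback–Leibler divergence KL(q ‖ π) = ∫ q(x) log(q(x)/π(x)) dx is finite, and let φ : ℝ^d → ℝ^d be continuously differentiable with compact support. For each real ε with |ε|·Lip(φ) < 1, where Lip(φ) is a Lipschitz constant of φ, let T_ε(x) = x + ε φ(x) and let q_{[εφ]} denote the pushforward under T_ε of the measure with density q; assume ε ↦ KL(q_{[εφ]} ‖ π) is finite for ε in a neighborhood of 0. Then this function of ε is differentiable at ε = 0 with derivative d/dε KL(q_{[εφ]} ‖ π)|_{ε=0} = − ∫_{ℝ^d} ( ⟨∇ log π(x), φ(x)⟩ + div φ(x) ) q(x) dx. -/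

import Mathlib

open MeasureTheory RealInnerProductSpace

/-- The Kullback–Leibler divergence `KL(μ ‖ ν) = ∫ log (dμ/dν) dμ`, as a real-valued
integral of the logarithm of the Radon–Nikodym derivative. -/
noncomputable def steinKL {α : Type*} [MeasurableSpace α]
    (μ ν : MeasureTheory.Measure α) : ℝ :=
  ∫ x, Real.log ((μ.rnDeriv ν x).toReal) ∂μ

section Determinant

variable {E : Type*} [NormedAddCommGroup E] [NormedSpace ℝ E] [FiniteDimensional ℝ E]

lemma ContinuousLinearMap.contDiff_det {n : WithTop ℕ∞} :
    ContDiff ℝ n (fun A : E →L[ℝ] E => A.det) := by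
  classical
  let b := Module.finBasis ℝ E
  have entry (i j) : ContDiff ℝ n (fun A : E →L[ℝ] E =>
      LinearMap.toMatrix b b (A : E →ₗ[ℝ] E) i j) := by
    simp only [LinearMap.toMatrix_apply, ContinuousLinearMap.coe_coe]
    exact (LinearMap.toContinuousLinearMap (b.coord i)).contDiff.comp
      (ContinuousLinearMap.apply ℝ E (b j)).contDiff
  have heq : (fun A : E →L[ℝ] E => A.det) = fun A : E →L[ℝ] E =>
      (LinearMap.toMatrix b b (A : E →ₗ[ℝ] E)).det := by
    ext A
    rw [LinearMap.det_toMatrix, ContinuousLinearMap.det]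
  rw [heq]
  simp only [Matrix.det_apply]
  exact ContDiff.sum fun σ _ => (contDiff_prod fun i _ => entry _ _).const_smul _

lemma ContinuousLinearMap.hasDerivAt_det_one_add_smul (A : E →L[ℝ] E) :
    HasDerivAt (fun t : ℝ => (1 + t • A).det) (LinearMap.trace ℝ E A) 0 := by
  classical
  let b := Module.finBasis ℝ E
  set M := LinearMap.toMatrix b b (A : E →ₗ[ℝ] E) with hM
  have heq : (fun t : ℝ => (1 + t • A).det) = fun t => (1 + t • M).det := by
    ext t
    rw [ContinuousLinearMap.det, ← LinearMap.det_toMatrix b]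
    congr 1
    simp [hM, LinearMap.toMatrix_one]
  rw [heq, LinearMap.trace_eq_matrix_trace ℝ b, ← hM]
  obtain ⟨p, hp⟩ : ∃ p : Polynomial ℝ, ∀ t : ℝ,
      (1 + t • M).det = 1 + M.trace * t + p.eval t * t ^ 2 :=
    ⟨_, fun t => Matrix.det_one_add_smul t M⟩
  simp only [hp]
  have h := (((hasDerivAt_id (0 : ℝ)).const_mul M.trace).const_add 1).add
    ((p.hasDerivAt 0).mul ((hasDerivAt_id (0 : ℝ)).pow 2))
  convert! h using 1
  simp

lemma ContinuousLinearMap.det_one_add_ne_zero_of_norm_lt_one {A : E →L[ℝ] E} (hA : ‖A‖ < 1) :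
    (1 + A).det ≠ 0 := by
  have : IsUnit (1 + A) := by
    have := isUnit_one_sub_of_norm_lt_one (x := -A) (by simpa using hA)
    simpa using this
  have h2 : IsUnit ((1 + A : E →L[ℝ] E) : E →ₗ[ℝ] E) :=
    this.map (ContinuousLinearMap.toLinearMapRingHom : (E →L[ℝ] E) →+* (E →ₗ[ℝ] E))
  exact (LinearMap.isUnit_det _ h2).ne_zero

end Determinant

section Pushforward

variable {E : Type*} [NormedAddCommGroup E] [NormedSpace ℝ E] [FiniteDimensional ℝ E]

lemma LipschitzWith.exists_homeomorph_id_add {K : NNReal} {f : E → E} (hf : LipschitzWith K f)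
    (hK : K < 1) : ∃ T : E ≃ₜ E, ∀ x, T x = x + f x := by
  have h : ApproximatesLinearOn (fun x => x + f x)
      ((ContinuousLinearEquiv.refl ℝ E : E ≃L[ℝ] E) : E →L[ℝ] E) Set.univ K := by
    intro x _ y _
    simpa [add_sub_add_comm] using hf.norm_sub_le x y
  refine ⟨h.toHomeomorph _ ?_, fun x => rfl⟩
  rcases subsingleton_or_nontrivial E with hE | hE
  · exact Or.inl hE
  · right
    have : ‖((ContinuousLinearEquiv.refl ℝ E : E ≃L[ℝ] E).symm : E →L[ℝ] E)‖₊ = 1 := by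
      simp
    simpa [this] using hK

variable [MeasurableSpace E] [BorelSpace E] (μ : Measure E) [μ.IsAddHaarMeasure]

lemma map_withDensity_eq_withDensity_of_homeomorph {p q : E → ℝ} (hp : Continuous p)
    (hp_pos : ∀ x, 0 < p x) (hq : Continuous q) (T : E ≃ₜ E) {T' : E → E →L[ℝ] E}
    (hT : ∀ x, HasFDerivAt T (T' x) x) (hT'_cont : Continuous T') (hT' : ∀ x, (T' x).det ≠ 0) :
    Measure.map T (μ.withDensity fun x => ENNReal.ofReal (q x)) =
      (μ.withDensity fun x => ENNReal.ofReal (p x)).withDensity fun y =>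
        ENNReal.ofReal (q (T.symm y) / (|(T' (T.symm y)).det| * p y)) := by
  have hdet : Continuous fun x => (T' x).det := ContinuousLinearMap.continuous_det.comp hT'_cont
  have hpm : Measurable fun x => ENNReal.ofReal (p x) := hp.measurable.ennreal_ofReal
  have hgm : Measurable fun y => ENNReal.ofReal (q (T.symm y) / (|(T' (T.symm y)).det| * p y)) := by
    refine (Continuous.div ?_ ?_ ?_).measurable.ennreal_ofReal
    · exact hq.comp T.symm.continuous
    · exact (hdet.comp T.symm.continuous).abs.mul hp
    · exact fun y => mul_ne_zero (abs_ne_zero.2 (hT' _)) (hp_pos y).ne'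
  rw [← withDensity_mul _ hpm hgm]
  ext s hs
  rw [Measure.map_apply T.continuous.measurable hs, withDensity_apply _ hs,
    withDensity_apply _ (T.continuous.measurable hs)]
  conv_rhs => rw [← Set.image_preimage_eq s T.surjective]
  rw [lintegral_image_eq_lintegral_abs_det_fderiv_mul μ (T.continuous.measurable hs)
    (fun x _ => (hT x).hasFDerivWithinAt) T.injective.injOn]
  refine lintegral_congr fun x => ?_
  have hd := abs_pos.2 (hT' x)
  have hpx := hp_pos (T x)
  rw [Pi.mul_apply, T.symm_apply_apply, ← ENNReal.ofReal_mul hpx.le,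
    ← ENNReal.ofReal_mul hd.le]
  congr 1
  field_simp

lemma steinKL_map_homeomorph {p q : E → ℝ} (hp : Continuous p)
    (hp_pos : ∀ x, 0 < p x) (hq : Continuous q) (hq_pos : ∀ x, 0 < q x)
    (T : E ≃ₜ E) {T' : E → E →L[ℝ] E}
    (hT : ∀ x, HasFDerivAt T (T' x) x) (hT'_cont : Continuous T') (hT' : ∀ x, (T' x).det ≠ 0) :
    steinKL (Measure.map T (μ.withDensity fun x => ENNReal.ofReal (q x)))
        (μ.withDensity fun x => ENNReal.ofReal (p x)) =
      ∫ x, q x * (Real.log (q x) - (Real.log (T' x).det + Real.log (p (T x)))) ∂μ := by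
  have hdet : Continuous fun x => (T' x).det := ContinuousLinearMap.continuous_det.comp hT'_cont
  have hmap := map_withDensity_eq_withDensity_of_homeomorph μ hp hp_pos hq T hT hT'_cont hT'
  have hgm : Measurable fun y => ENNReal.ofReal (q (T.symm y) / (|(T' (T.symm y)).det| * p y)) := by
    refine (Continuous.div ?_ ?_ ?_).measurable.ennreal_ofReal
    · exact hq.comp T.symm.continuous
    · exact (hdet.comp T.symm.continuous).abs.mul hp
    · exact fun y => mul_ne_zero (abs_ne_zero.2 (hT' _)) (hp_pos y).ne'
  have : SigmaFinite (μ.withDensity fun x => ENNReal.ofReal (p x)) :=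
    SigmaFinite.withDensity_ofReal _
  have hrn : (Measure.map T (μ.withDensity fun x => ENNReal.ofReal (q x))).rnDeriv
      (μ.withDensity fun x => ENNReal.ofReal (p x))
      =ᵐ[Measure.map T (μ.withDensity fun x => ENNReal.ofReal (q x))]
      fun y => ENNReal.ofReal (q (T.symm y) / (|(T' (T.symm y)).det| * p y)) := by
    rw [hmap]
    exact (withDensity_absolutelyContinuous _ _).ae_eq (Measure.rnDeriv_withDensity _ hgm)
  rw [steinKL, integral_congr_ae (hrn.mono fun _ hy => congrArg (fun z => Real.log z.toReal) hy),
    T.measurableEmbedding.integral_map,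
    integral_withDensity_eq_integral_toReal_smul hq.measurable.ennreal_ofReal (by simp)]
  refine integral_congr_ae (Filter.Eventually.of_forall fun x => ?_)
  have hd := abs_pos.2 (hT' x)
  have hqx := hq_pos x
  have hpx := hp_pos (T x)
  simp only [T.symm_apply_apply, smul_eq_mul]
  rw [ENNReal.toReal_ofReal hqx.le, ENNReal.toReal_ofReal (by positivity),
    Real.log_div hqx.ne' (by positivity), Real.log_mul hd.ne' hpx.ne', Real.log_abs]

end Pushforward

section LogJacobian

lemma isOpen_setOf_det_one_add_smul_ne_zero {E : Type*} [NormedAddCommGroup E]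
    [NormedSpace ℝ E] :
    IsOpen {z : ℝ × (E →L[ℝ] E) × E × E | (1 + z.1 • z.2.1).det ≠ 0} :=
  isOpen_ne_fun (ContinuousLinearMap.continuous_det.comp (by fun_prop)) continuous_const

variable {E : Type*} [NormedAddCommGroup E] [NormedSpace ℝ E] [FiniteDimensional ℝ E]

/-- The log-density picked up along the segment `t ↦ x + t • v` by a map whose Jacobian there is
`1 + t • A`, as a function of `(t, A, x, v)`. -/
noncomputable def logJacobianDensity (p : E → ℝ) (z : ℝ × (E →L[ℝ] E) × E × E) : ℝ :=
  Real.log (1 + z.1 • z.2.1).det + Real.log (p (z.2.2.1 + z.1 • z.2.2.2))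

lemma contDiffOn_logJacobianDensity {p : E → ℝ} (hp : ContDiff ℝ 1 p) (hp_pos : ∀ x, 0 < p x) :
    ContDiffOn ℝ 1 (logJacobianDensity p) {z | (1 + z.1 • z.2.1).det ≠ 0} := by
  have hdet : ContDiff ℝ 1 fun z : ℝ × (E →L[ℝ] E) × E × E => (1 + z.1 • z.2.1).det :=
    ContinuousLinearMap.contDiff_det.comp (by fun_prop)
  have hlin : ContDiff ℝ 1 fun z : ℝ × (E →L[ℝ] E) × E × E => z.2.2.1 + z.1 • z.2.2.2 := by
    fun_prop
  exact (hdet.contDiffOn.log fun z hz => hz).add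
    ((hp.comp hlin).log fun z => (hp_pos _).ne').contDiffOn

lemma continuousOn_fderiv_logJacobianDensity {p : E → ℝ} (hp : ContDiff ℝ 1 p)
    (hp_pos : ∀ x, 0 < p x) :
    ContinuousOn (fun z => fderiv ℝ (logJacobianDensity p) z (1, 0))
      {z | (1 + z.1 • z.2.1).det ≠ 0} :=
  ((contDiffOn_logJacobianDensity hp hp_pos).continuousOn_fderiv_of_isOpen
    isOpen_setOf_det_one_add_smul_ne_zero le_rfl).clm_apply continuousOn_const

lemma hasDerivAt_logJacobianDensity {p : E → ℝ} (hp : ContDiff ℝ 1 p) (hp_pos : ∀ x, 0 < p x)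
    {t : ℝ} {w : (E →L[ℝ] E) × E × E} (hw : (1 + t • w.1).det ≠ 0) :
    HasDerivAt (fun s => logJacobianDensity p (s, w))
      (fderiv ℝ (logJacobianDensity p) (t, w) (1, 0)) t := by
  have h : HasFDerivAt (logJacobianDensity p) (fderiv ℝ (logJacobianDensity p) (t, w)) (t, w) :=
    (((contDiffOn_logJacobianDensity hp hp_pos).contDiffAt
    (isOpen_setOf_det_one_add_smul_ne_zero.mem_nhds hw)).differentiableAt one_ne_zero).hasFDerivAt
  exact h.comp_hasDerivAt t ((hasDerivAt_id t).prodMk (hasDerivAt_const t w))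

lemma fderiv_logJacobianDensity_zero {p : E → ℝ} (hp : ContDiff ℝ 1 p) (hp_pos : ∀ x, 0 < p x)
    (A : E →L[ℝ] E) (x v : E) :
    fderiv ℝ (logJacobianDensity p) (0, A, x, v) (1, 0) =
      LinearMap.trace ℝ E A + fderiv ℝ (fun y => Real.log (p y)) x v := by
  have hone : ((1 : E →L[ℝ] E) + (0 : ℝ) • A).det = 1 := by simp [ContinuousLinearMap.det]
  refine (hasDerivAt_logJacobianDensity hp hp_pos (w := (A, x, v)) ?_).unique ?_
  · exact hone.trans_ne one_ne_zero
  have hlog : DifferentiableAt ℝ (fun y => Real.log (p y)) x :=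
    (hp.differentiable one_ne_zero x).log (hp_pos x).ne'
  have hline : HasDerivAt (fun t : ℝ => x + t • v) v 0 := by
    simpa using ((hasDerivAt_id (0 : ℝ)).smul_const v).const_add x
  have hdet := A.hasDerivAt_det_one_add_smul.log (by rw [hone]; exact one_ne_zero)
  rw [hone, div_one] at hdet
  refine hdet.add ?_
  refine HasFDerivAt.comp_hasDerivAt (f := fun t : ℝ => x + t • v)
    (l := fun y => Real.log (p y)) 0 ?_ hline
  simpa using hlog.hasFDerivAt

lemma fderiv_logJacobianDensity_stationary {p : E → ℝ} (hp : ContDiff ℝ 1 p)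
    (hp_pos : ∀ x, 0 < p x) (t : ℝ) (x : E) :
    fderiv ℝ (logJacobianDensity p) (t, 0, x, 0) (1, 0) = 0 := by
  refine (hasDerivAt_logJacobianDensity hp hp_pos (w := (0, x, 0)) ?_).unique ?_
  · simp [ContinuousLinearMap.det]
  · simpa [logJacobianDensity] using hasDerivAt_const t _

variable [MeasurableSpace E] [BorelSpace E] (μ : Measure E) [μ.IsAddHaarMeasure]

lemma hasDerivAt_steinKL_map_add_smul {p q : E → ℝ} (hp_smooth : ContDiff ℝ 1 p)
    (hp_pos : ∀ x, 0 < p x) (hq_smooth : ContDiff ℝ 1 q) (hq_pos : ∀ x, 0 < q x)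
    (hq_int : Integrable q μ) (hKL_fin : Integrable (fun x => q x * Real.log (q x / p x)) μ)
    {φ : E → E} (hφ_smooth : ContDiff ℝ 1 φ) (hφ_supp : HasCompactSupport φ)
    {L : NNReal} (hφ_lip : LipschitzWith L φ) :
    HasDerivAt
      (fun t : ℝ => steinKL (Measure.map (fun x => x + t • φ x)
          (μ.withDensity fun x => ENNReal.ofReal (q x)))
        (μ.withDensity fun x => ENNReal.ofReal (p x)))
      (∫ x, q x * -(LinearMap.trace ℝ E (fderiv ℝ φ x) +
        fderiv ℝ (fun y => Real.log (p y)) x (φ x)) ∂μ) 0 := by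
  let r : ℝ := 1 / (2 * (L + 1))
  have hr : 0 < r := by positivity
  have hrL : r * L < 1 := by
    have : (0 : ℝ) ≤ L := L.2
    rw [div_mul_eq_mul_div, div_lt_one (by positivity)]
    linarith
  let w : E → (E →L[ℝ] E) × E × E := fun x => (fderiv ℝ φ x, x, φ x)
  have hφ' : Continuous (fderiv ℝ φ) := hφ_smooth.continuous_fderiv one_ne_zero
  have hw : Continuous w := hφ'.prodMk (continuous_id.prodMk hφ_smooth.continuous)
  have hdet (t : ℝ) (ht : t ∈ Metric.closedBall (0 : ℝ) r) (x : E) :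
      (1 + t • fderiv ℝ φ x).det ≠ 0 := by
    apply ContinuousLinearMap.det_one_add_ne_zero_of_norm_lt_one
    rw [norm_smul]
    refine lt_of_le_of_lt ?_ hrL
    gcongr
    · simpa using ht
    · exact norm_fderiv_le_of_lipschitz ℝ hφ_lip
  have hKL (t : ℝ) (ht : t ∈ Metric.closedBall (0 : ℝ) r) :
      steinKL (Measure.map (fun x => x + t • φ x)
          (μ.withDensity fun x => ENNReal.ofReal (q x)))
        (μ.withDensity fun x => ENNReal.ofReal (p x)) =
      ∫ x, q x * (Real.log (q x) - logJacobianDensity p (t, w x)) ∂μ := by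
    have hlip : LipschitzWith (‖t‖₊ * L) fun x => t • φ x :=
      (lipschitzWith_smul t).comp hφ_lip
    obtain ⟨T, hT⟩ := hlip.exists_homeomorph_id_add (by
      rw [← NNReal.coe_lt_coe]
      push_cast
      refine lt_of_le_of_lt ?_ hrL
      gcongr
      simpa using ht)
    have hTfun : (T : E → E) = fun x => x + t • φ x := funext hT
    have h := steinKL_map_homeomorph μ hp_smooth.continuous hp_pos hq_smooth.continuous hq_pos
      T (T' := fun x => 1 + t • fderiv ℝ φ x) (fun x => ?_) (by fun_prop) (hdet t ht)
    · rw [hTfun] at h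
      exact h
    · rw [hTfun]
      exact (hasFDerivAt_id x).add
        ((hφ_smooth.differentiable one_ne_zero x).hasFDerivAt.const_smul t)
  obtain ⟨C, hC⟩ : ∃ C, ∀ t ∈ Metric.closedBall (0 : ℝ) r, ∀ x,
      ‖fderiv ℝ (logJacobianDensity p) (t, w x) (1, 0)‖ ≤ C := by
    have hcont : ContinuousOn
        (fun z : ℝ × E => fderiv ℝ (logJacobianDensity p) (z.1, w z.2) (1, 0))
        (Metric.closedBall 0 r ×ˢ tsupport φ) :=
      (continuousOn_fderiv_logJacobianDensity hp_smooth hp_pos).comp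
        (f := fun z : ℝ × E => (z.1, w z.2)) (by fun_prop) fun z hz => hdet z.1 hz.1 z.2
    obtain ⟨C, hC⟩ := ((isCompact_closedBall (0 : ℝ) r).prod
      hφ_supp).exists_bound_of_continuousOn hcont
    refine ⟨max C 0, fun t ht x => ?_⟩
    by_cases hx : x ∈ tsupport φ
    · exact (hC (t, x) ⟨ht, hx⟩).trans (le_max_left _ _)
    · have hwx : w x = (0, x, 0) := by
        simp only [w, image_eq_zero_of_notMem_tsupport hx, Prod.mk.injEq, and_true]
        exact image_eq_zero_of_notMem_tsupport fun h => hx (tsupport_fderiv_subset ℝ h)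
      rw [hwx, fderiv_logJacobianDensity_stationary hp_smooth hp_pos, norm_zero]
      exact le_max_right _ _
  have hmem : Metric.closedBall (0 : ℝ) r ∈ nhds (0 : ℝ) := Metric.closedBall_mem_nhds _ hr
  have hq_log : Continuous fun x => Real.log (q x) :=
    hq_smooth.continuous.log fun x => (hq_pos x).ne'
  have hder := (hasDerivAt_integral_of_dominated_loc_of_deriv_le (μ := μ) (x₀ := (0 : ℝ))
    (F := fun t x => q x * (Real.log (q x) - logJacobianDensity p (t, w x)))
    (F' := fun t x => q x * (0 - fderiv ℝ (logJacobianDensity p) (t, w x) (1, 0)))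
    (bound := fun x => q x * C) hmem ?_ ?_ ?_ ?_ (hq_int.mul_const C) ?_).2
  · refine (hder.congr_of_eventuallyEq (Filter.eventually_of_mem hmem hKL)).congr_deriv ?_
    simp only [w, fderiv_logJacobianDensity_zero hp_smooth hp_pos, zero_sub]
  · filter_upwards [hmem] with t ht
    have hcont : Continuous fun x => logJacobianDensity p (t, w x) :=
      (contDiffOn_logJacobianDensity hp_smooth hp_pos).continuousOn.comp_continuous
        (by fun_prop) (hdet t ht)
    exact (hq_smooth.continuous.mul (hq_log.sub hcont)).aestronglyMeasurable
  · refine hKL_fin.congr (Filter.Eventually.of_forall fun x => ?_)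
    simp [logJacobianDensity, w, Real.log_div (hq_pos x).ne' (hp_pos x).ne',
      ContinuousLinearMap.det]
  · have hcont : Continuous fun x => fderiv ℝ (logJacobianDensity p) (0, w x) (1, 0) :=
      (continuousOn_fderiv_logJacobianDensity hp_smooth hp_pos).comp_continuous
        (f := fun x => ((0 : ℝ), w x)) (by fun_prop) (hdet 0 (Metric.mem_closedBall_self hr.le))
    exact (hq_smooth.continuous.mul (continuous_const.sub hcont)).aestronglyMeasurable
  · refine Filter.Eventually.of_forall fun x t ht => ?_
    rw [norm_mul, zero_sub, norm_neg, Real.norm_of_nonneg (hq_pos x).le]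
    exact mul_le_mul_of_nonneg_left (hC t ht x) (hq_pos x).le
  · refine Filter.Eventually.of_forall fun x t ht => ?_
    exact ((hasDerivAt_const t _).sub
      (hasDerivAt_logJacobianDensity hp_smooth hp_pos (hdet t ht x))).const_mul (q x)

end LogJacobian

/-- **Liu–Wang identity (Eq. (2.3)).** For strictly positive `C¹` probability densities
`π'` and `q` on `ℝ^d` with `KL(q ‖ π')` finite, and a compactly supported `C¹` vector
field `φ` which is Lipschitz with constant `L`, consider for `|ε| * L < 1` the transport
map `T_ε(x) = x + ε • φ(x)` and the pushforward `q_{[εφ]}` of the measure with density `q`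
under `T_ε`.  Assuming `ε ↦ KL(q_{[εφ]} ‖ π')` is finite for `ε` near `0`, this function
is differentiable at `ε = 0` with derivative
`− ∫ (⟪∇ log π' x, φ x⟫ + div φ x) q x dx`. -/
theorem svgd_kl_derivative
    (d : ℕ) (hd : 0 < d)
    (π' q : EuclideanSpace ℝ (Fin d) → ℝ)
    (hπ_smooth : ContDiff ℝ 1 π')
    (hπ_pos : ∀ x, 0 < π' x)
    (hπ_prob : ∫ x, π' x = 1)
    (hq_smooth : ContDiff ℝ 1 q)
    (hq_pos : ∀ x, 0 < q x)
    (hq_prob : ∫ x, q x = 1)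
    (hKL_fin : Integrable (fun x => q x * Real.log (q x / π' x)))
    (φ : EuclideanSpace ℝ (Fin d) → EuclideanSpace ℝ (Fin d))
    (hφ_smooth : ContDiff ℝ 1 φ)
    (hφ_supp : HasCompactSupport φ)
    (L : NNReal) (hφ_lip : LipschitzWith L φ)
    (hnear : ∀ᶠ ε in nhds (0 : ℝ),
      Integrable
        (fun x => Real.log
          (((MeasureTheory.Measure.map (fun x => x + ε • φ x)
              (volume.withDensity fun x => ENNReal.ofReal (q x))).rnDeriv
            (volume.withDensity fun x => ENNReal.ofReal (π' x)) x).toReal))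
        (MeasureTheory.Measure.map (fun x => x + ε • φ x)
          (volume.withDensity fun x => ENNReal.ofReal (q x)))) :
    HasDerivAt
      (fun ε : ℝ =>
        steinKL
          (MeasureTheory.Measure.map (fun x => x + ε • φ x)
            (volume.withDensity fun x => ENNReal.ofReal (q x)))
          (volume.withDensity fun x => ENNReal.ofReal (π' x)))
      (-∫ x, (⟪gradient (fun y => Real.log (π' y)) x, φ x⟫
          + ∑ k, fderiv ℝ φ x (EuclideanSpace.single k 1) k) * q x)
      0 := by
  have hq_int : Integrable q := by
    by_contra h
    simp [integral_undef h] at hq_prob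
  refine (hasDerivAt_steinKL_map_add_smul volume hπ_smooth hπ_pos hq_smooth hq_pos hq_int hKL_fin
    hφ_smooth hφ_supp hφ_lip).congr_deriv ?_
  rw [← integral_neg]
  refine integral_congr_ae (Filter.Eventually.of_forall fun x => ?_)
  have htr : LinearMap.trace ℝ (EuclideanSpace ℝ (Fin d)) (fderiv ℝ φ x) =
      ∑ k, fderiv ℝ φ x (EuclideanSpace.single k 1) k := by
    rw [LinearMap.trace_eq_matrix_trace ℝ (EuclideanSpace.basisFun (Fin d) ℝ).toBasis]
    simp [Matrix.trace, LinearMap.toMatrix_apply]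
  have hgrad : ⟪gradient (fun y => Real.log (π' y)) x, φ x⟫ =
      fderiv ℝ (fun y => Real.log (π' y)) x (φ x) := by
    simp [gradient]
  simp only [htr, hgrad]
  ring
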